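/- Let A^(1),…,A^(k) ∈ ℝ₊^{n×n} be Kleene stars. The following are equivalent: (1) span(A^(1)) ∩ … ∩ span(A^(k)) contains a vector all of whose coordinates are positive; (2) λ(A^(1) ⊕ … ⊕ A^(k)) = 1; (3) λ(A^{(π(1))} ⊗ … ⊗ A^{(π(k))}) = 1 for some permutation π of [k]; (4) λ(A^{(π(1))} ⊗ … ⊗ A^{(π(k))}) = 1 for all permutations π of [k]. If these hold, then span(A^(1)) ∩ … ∩ span(A^(k)) = span((A^(1) ⊕ … ⊕ A^(k))*) = span((A^{(π(1))} ⊗ … ⊗ A^{(π(k))})*) for every permutation π of [k]. -/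

import Mathlib

open scoped NNReal Classical

namespace MaxAlg

noncomputable section

variable {n m k N : ℕ}

/-- Support of a vector in `ℝ₊ⁿ`. -/
def supp (y : Fin n → ℝ≥0) : Set (Fin n) := { i | y i ≠ 0 }

/-- The multiorder relation `u ≤_j v`. -/
def leOrd (j : Fin n) (u v : Fin n → ℝ≥0) : Prop :=
  u j ≠ 0 ∧ v j ≠ 0 ∧ ∀ i, u i / u j ≤ v i / v j

/-- Max span of a set of vectors: all finite max combinations. -/
def maxSpan (S : Set (Fin n → ℝ≥0)) : Set (Fin n → ℝ≥0) :=
  { y | ∃ (F : Finset (Fin n → ℝ≥0)) (lam : (Fin n → ℝ≥0) → ℝ≥0),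
      ↑F ⊆ S ∧ y = F.sup fun v => lam v • v }

/-- A max cone: closed under componentwise max and nonnegative scaling. -/
def IsMaxCone (V : Set (Fin n → ℝ≥0)) : Prop :=
  (∀ u ∈ V, ∀ w ∈ V, u ⊔ w ∈ V) ∧ ∀ (c : ℝ≥0), ∀ u ∈ V, c • u ∈ V

/-- Extremal vector of a max cone. -/
def IsExtremal (V : Set (Fin n → ℝ≥0)) (v : Fin n → ℝ≥0) : Prop :=
  v ∈ V ∧ v ≠ 0 ∧ ∀ u ∈ V, ∀ w ∈ V, v = u ⊔ w → v = u ∨ v = w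

/-- Minimality w.r.t. `≤_j` in a set `W`. -/
def MinimalOrd (j : Fin n) (W : Set (Fin n → ℝ≥0)) (v : Fin n → ℝ≥0) : Prop :=
  v ∈ W ∧ v j ≠ 0 ∧ ∀ u ∈ W, leOrd j u v → leOrd j v u

/-- Max-algebraic matrix-vector product. -/
def mulVec (A : Matrix (Fin n) (Fin m) ℝ≥0) (x : Fin m → ℝ≥0) : Fin n → ℝ≥0 :=
  fun i => Finset.univ.sup fun j => A i j * x j

/-- Max-algebraic column span of a matrix. -/
def matSpan (A : Matrix (Fin n) (Fin m) ℝ≥0) : Set (Fin n → ℝ≥0) :=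
  { y | ∃ x : Fin m → ℝ≥0, y = mulVec A x }

/-- Max-algebraic matrix product. -/
def mProd (A B : Matrix (Fin n) (Fin n) ℝ≥0) : Matrix (Fin n) (Fin n) ℝ≥0 :=
  fun i j => Finset.univ.sup fun t => A i t * B t j

/-- Max-algebraic identity matrix. -/
def mId (n : ℕ) : Matrix (Fin n) (Fin n) ℝ≥0 :=
  fun i j => if i = j then 1 else 0

/-- Max-algebraic matrix power. -/
def mPow (A : Matrix (Fin n) (Fin n) ℝ≥0) : ℕ → Matrix (Fin n) (Fin n) ℝ≥0
  | 0 => mId n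
  | t + 1 => mProd (mPow A t) A

/-- Maximum cycle geometric mean `λ(A)`. -/
def maxCycleMean (A : Matrix (Fin n) (Fin n) ℝ≥0) : ℝ≥0 :=
  sSup { w | ∃ (p : ℕ) (hp : 0 < p) (c : Fin p → Fin n),
    w = (∏ t : Fin p, A (c t) (c ⟨((t : ℕ) + 1) % p, Nat.mod_lt _ hp⟩)) ^ ((1 : ℝ) / (p : ℝ)) }

/-- Kleene star `A* = I ⊕ A ⊕ ⋯ ⊕ A^{n-1}`. -/
def kleene (A : Matrix (Fin n) (Fin n) ℝ≥0) : Matrix (Fin n) (Fin n) ℝ≥0 :=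
  fun i j => (Finset.range n).sup fun t => mPow A t i j

/-- Eigencone `V(A)`. -/
def eigCone (A : Matrix (Fin n) (Fin n) ℝ≥0) : Set (Fin n → ℝ≥0) :=
  { x | mulVec A x = x }

/-- Subeigencone `V*(A)`. -/
def subEigCone (A : Matrix (Fin n) (Fin n) ℝ≥0) : Set (Fin n → ℝ≥0) :=
  { x | mulVec A x ≤ x }

/-- Kleene star predicate: multiplicatively idempotent with unit diagonal. -/
def IsKleeneStar (Q : Matrix (Fin n) (Fin n) ℝ≥0) : Prop :=
  mProd Q Q = Q ∧ ∀ i, Q i i = 1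

/-- Projector onto a (closed) max cone: `P_V(y) = max{v ∈ V ∣ v ≤ y}`. -/
def proj (V : Set (Fin n → ℝ≥0)) (y : Fin n → ℝ≥0) : Fin n → ℝ≥0 :=
  fun i => sSup ((fun v => v i) '' { v ∈ V | v ≤ y })

/-- Residuation `y / v = min_{i ∈ supp v} yᵢ/vᵢ`. -/
def resid (y v : Fin n → ℝ≥0) : ℝ≥0 :=
  sInf ((fun i => y i / v i) '' supp v)

/-- `(i,j)` is a critical edge: it lies on a cycle of geometric-mean weight 1. -/
def IsCriticalEdge (B : Matrix (Fin n) (Fin n) ℝ≥0) (i j : Fin n) : Prop :=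
  ∃ (p : ℕ) (hp : 0 < p) (c : Fin p → Fin n) (t : Fin p),
    c t = i ∧ c ⟨((t : ℕ) + 1) % p, Nat.mod_lt _ hp⟩ = j ∧
    (∏ s : Fin p, B (c s) (c ⟨((s : ℕ) + 1) % p, Nat.mod_lt _ hp⟩)) ^ ((1 : ℝ) / (p : ℝ)) = 1

/-- The matrix `A^S` associated with an `n`-tuple `S` of subsets of `[m]`. -/
def typeMat (A : Matrix (Fin n) (Fin m) ℝ≥0) (S : Fin n → Set (Fin m)) :
    Matrix (Fin n) (Fin n) ℝ≥0 :=
  fun i j =>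
    if S j = ∅ then (if i = j then 1 else 0)
    else sSup ((fun t => A i t / A j t) '' S j)

/-- The closed region `cl(X_S)`. -/
def clRegion (A : Matrix (Fin n) (Fin m) ℝ≥0) (S : Fin n → Set (Fin m)) :
    Set (Fin n → ℝ≥0) :=
  { y | ∀ t i : Fin n, ∀ j ∈ S i, A t j / A i j * y i ≤ y t }

/-- Row type of a positive vector w.r.t. a matrix. -/
def rowType (A : Matrix (Fin n) (Fin m) ℝ≥0) (y : Fin n → ℝ≥0) : Fin n → Set (Fin m) :=
  fun i => { j | ∀ t, A t j / y t ≤ A i j / y i }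

/-- Max-algebraic permanent. -/
def maxPer (A : Matrix (Fin n) (Fin n) ℝ≥0) : ℝ≥0 :=
  Finset.univ.sup fun σ : Equiv.Perm (Fin n) => ∏ i, A i (σ i)

/-- Max-algebraic pseudoinverse `A^∇ = per(A)⁻¹ ⋅ A^adj`, where
`(A^adj)_{ij} = per(A_{ji})`. -/
def pinv (A : Matrix (Fin (N + 1)) (Fin (N + 1)) ℝ≥0) :
    Matrix (Fin (N + 1)) (Fin (N + 1)) ℝ≥0 :=
  fun i j => (maxPer A)⁻¹ * maxPer (A.submatrix j.succAbove i.succAbove)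

/-- Column normalization `A^{cσ}`. -/
def colNorm (A : Matrix (Fin n) (Fin n) ℝ≥0) (σ : Equiv.Perm (Fin n)) :
    Matrix (Fin n) (Fin n) ℝ≥0 :=
  fun i j => A i (σ j) / A j (σ j)

/-- Row normalization `A^{rσ}`. -/
def rowNorm (A : Matrix (Fin n) (Fin n) ℝ≥0) (σ : Equiv.Perm (Fin n)) :
    Matrix (Fin n) (Fin n) ℝ≥0 :=
  fun i j => A (σ.symm i) j / A (σ.symm i) i

/-- The diagonal matrix `D^σ`. -/
def permDiag (A : Matrix (Fin n) (Fin n) ℝ≥0) (σ : Equiv.Perm (Fin n)) :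
    Matrix (Fin n) (Fin n) ℝ≥0 :=
  fun i j => if j = σ i then A i j else 0

/-- The cyclic projector `P_k ∘ ⋯ ∘ P_1` onto the column spans of a family of matrices. -/
def cycProj {mdim : Fin k → ℕ} (A : (s : Fin k) → Matrix (Fin n) (Fin (mdim s)) ℝ≥0) :
    (Fin n → ℝ≥0) → Fin n → ℝ≥0 :=
  fun y => (List.ofFn fun s => proj (matSpan (A s))).foldl (fun z f => f z) y

/-- The max-algebraic product `A^(1) ⊗ ⋯ ⊗ A^(k)` of a family of matrices. -/
def prodAll (A : Fin k → Matrix (Fin n) (Fin n) ℝ≥0) : Matrix (Fin n) (Fin n) ℝ≥0 :=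
  (List.ofFn A).foldr mProd (mId n)

/-- The sequence of products `C^(m) = A^{(j(m))} ⊗ ⋯ ⊗ A^{(j(1))}`. -/
def prodSeq (A : Fin k → Matrix (Fin n) (Fin n) ℝ≥0) (j : ℕ → Fin k) :
    ℕ → Matrix (Fin n) (Fin n) ℝ≥0
  | 0 => mId n
  | t + 1 => mProd (A (j (t + 1))) (prodSeq A j t)

/-- Hilbert projective distance, valued in the extended reals. -/
def rhoH (y1 y2 : Fin n → ℝ≥0) : EReal :=
  if supp y1 = supp y2 then
    ((Real.log ((sSup { t : ℝ≥0 | ∃ i ∈ supp y1, ∃ j ∈ supp y1,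
        t = y1 i / y2 i * (y2 j / y1 j) } : ℝ≥0) : ℝ)) : EReal)
  else ⊤

/-- Max-plus (additive) matrix-vector product over `ℝ`. -/
def mpMulVec (A : Matrix (Fin n) (Fin m) ℝ) (x : Fin m → ℝ) : Fin n → ℝ :=
  fun i => ⨆ j, (A i j + x j)

/-- Min-plus residuated product `Ā ⊗' y` over `ℝ`. -/
def mpDual (A : Matrix (Fin n) (Fin m) ℝ) (y : Fin n → ℝ) : Fin m → ℝ :=
  fun j => ⨅ i, (y i - A i j)

/-- Max-plus projector onto the column span of `A`: `P_A(y) = A ⊗ (Ā ⊗' y)`. -/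
def mpProj (A : Matrix (Fin n) (Fin m) ℝ) (y : Fin n → ℝ) : Fin n → ℝ :=
  mpMulVec A (mpDual A y)

/-- Range seminorm `‖A‖ = max_{i,j,l}(a_{il} − a_{jl})`. -/
def mpNorm (A : Matrix (Fin n) (Fin m) ℝ) : ℝ :=
  ⨆ i, ⨆ j, ⨆ l, (A i l - A j l)

/-- One sweep `P_k ∘ ⋯ ∘ P_1` of the max-plus alternating method. -/
def altStep {mdim : Fin k → ℕ} (A : (s : Fin k) → Matrix (Fin n) (Fin (mdim s)) ℝ) :
    (Fin n → ℝ) → Fin n → ℝ :=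
  fun y => (List.ofFn fun s => mpProj (A s)).foldl (fun z f => f z) y

end

theorem mulVec_le_iff {n m : ℕ} {M : Matrix (Fin n) (Fin m) ℝ≥0} {x : Fin m → ℝ≥0}
    {y : Fin n → ℝ≥0} : mulVec M x ≤ y ↔ ∀ i j, M i j * x j ≤ y i := by
  simp [mulVec, Pi.le_def]

theorem mem_subEigCone_iff {n : ℕ} {M : Matrix (Fin n) (Fin n) ℝ≥0} {x : Fin n → ℝ≥0} :
    x ∈ subEigCone M ↔ ∀ i j, M i j * x j ≤ x i :=
  mulVec_le_iff

theorem mul_le_mulVec {n m : ℕ} (M : Matrix (Fin n) (Fin m) ℝ≥0) (x : Fin m → ℝ≥0)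
    (i : Fin n) (j : Fin m) : M i j * x j ≤ mulVec M x i :=
  mulVec_le_iff.1 le_rfl i j

theorem mProd_le_iff {n : ℕ} {M N : Matrix (Fin n) (Fin n) ℝ≥0} {i j : Fin n} {r : ℝ≥0} :
    mProd M N i j ≤ r ↔ ∀ t, M i t * N t j ≤ r := by
  simp [mProd]

theorem mul_le_mProd {n : ℕ} (M N : Matrix (Fin n) (Fin n) ℝ≥0) (i t j : Fin n) :
    M i t * N t j ≤ mProd M N i j :=
  mProd_le_iff.1 le_rfl t

theorem mulVec_mProd_le_iff {n : ℕ} {M N : Matrix (Fin n) (Fin n) ℝ≥0} {x y : Fin n → ℝ≥0} :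
    mulVec (mProd M N) x ≤ y ↔ mulVec M (mulVec N x) ≤ y := by
  simp only [mulVec, mProd, Pi.le_def, Finset.sup_le_iff, Finset.mem_univ, true_implies,
    NNReal.finset_sup_mul, NNReal.mul_finset_sup, mul_assoc]
  exact forall_congr' fun _ => forall_comm

/-- The span of a matrix with unit diagonal that absorbs `M` on the left and fixes every
subeigenvector of `M` is the subeigencone of `M`. -/
theorem matSpan_eq_subEigCone {n : ℕ} {M Q : Matrix (Fin n) (Fin n) ℝ≥0}
    (hdiag : ∀ i, 1 ≤ Q i i) (hmul : ∀ i t j, M i t * Q t j ≤ Q i j)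
    (hsub : subEigCone M ⊆ subEigCone Q) : matSpan Q = subEigCone M := by
  ext x
  constructor
  · rintro ⟨z, rfl⟩
    refine mulVec_mProd_le_iff.1 (mulVec_le_iff.2 fun i j => ?_)
    exact (mul_le_mul_left (mProd_le_iff.2 fun t => hmul i t j) _).trans (mul_le_mulVec Q z i j)
  · intro hx
    refine ⟨x, le_antisymm (fun i => ?_) (hsub hx)⟩
    calc x i = 1 * x i := (one_mul _).symm
      _ ≤ Q i i * x i := mul_le_mul_left (hdiag i) _
      _ ≤ mulVec Q x i := mul_le_mulVec Q x i i

theorem IsKleeneStar.matSpan_eq {n : ℕ} {Q : Matrix (Fin n) (Fin n) ℝ≥0} (hQ : IsKleeneStar Q) :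
    matSpan Q = subEigCone Q := by
  refine matSpan_eq_subEigCone (fun i => (hQ.2 i).ge) (fun i t j => ?_) subset_rfl
  calc Q i t * Q t j ≤ mProd Q Q i j := mul_le_mProd Q Q i t j
    _ = Q i j := by rw [hQ.1]

section CycleMean

variable {n : ℕ} (M : Matrix (Fin n) (Fin n) ℝ≥0)

/-- The cyclic successor on `Fin p` is bijective. -/
theorem cyclic_succ_bijective {p : ℕ} (hp : 0 < p) :
    Function.Bijective fun t : Fin p => (⟨((t : ℕ) + 1) % p, Nat.mod_lt _ hp⟩ : Fin p) := by
  obtain ⟨q, rfl⟩ := Nat.exists_eq_succ_of_ne_zero hp.ne'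
  convert (Equiv.addRight (1 : Fin (q + 1))).bijective using 1
  ext t
  simp [Fin.val_add]

theorem cycle_prod_le_one_of_subEig {x : Fin n → ℝ≥0} (hx : x ∈ subEigCone M)
    (hpos : ∀ i, 0 < x i) (p : ℕ) (hp : 0 < p) (c : Fin p → Fin n) :
    ∏ t : Fin p, M (c t) (c ⟨((t : ℕ) + 1) % p, Nat.mod_lt _ hp⟩) ≤ 1 := by
  have hle : ∏ t : Fin p, (M (c t) (c ⟨((t : ℕ) + 1) % p, Nat.mod_lt _ hp⟩) *
      x (c ⟨((t : ℕ) + 1) % p, Nat.mod_lt _ hp⟩)) ≤ ∏ t : Fin p, x (c t) :=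
    Finset.prod_le_prod' fun t _ => mem_subEigCone_iff.1 hx _ _
  rw [Finset.prod_mul_distrib,
    (cyclic_succ_bijective hp).prod_comp fun t => x (c t)] at hle
  refine le_of_mul_le_mul_right (hle.trans_eq (one_mul _).symm) ?_
  exact Finset.prod_pos fun t _ => hpos _

theorem bddAbove_cycle_means :
    BddAbove { w : ℝ≥0 | ∃ (p : ℕ) (hp : 0 < p) (c : Fin p → Fin n),
      w = (∏ t : Fin p, M (c t) (c ⟨((t : ℕ) + 1) % p, Nat.mod_lt _ hp⟩)) ^
        ((1 : ℝ) / (p : ℝ)) } := by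
  refine ⟨Finset.univ.sup fun i => Finset.univ.sup fun j => M i j, ?_⟩
  rintro w ⟨p, hp, c, rfl⟩
  have hentry : ∀ i j, M i j ≤ Finset.univ.sup fun i => Finset.univ.sup fun j => M i j :=
    fun i j => (Finset.le_sup (f := fun j => M i j) (Finset.mem_univ j)).trans
      (Finset.le_sup (f := fun i => Finset.univ.sup fun j => M i j) (Finset.mem_univ i))
  rw [one_div, NNReal.rpow_inv_le_iff (by exact_mod_cast hp), NNReal.rpow_natCast]
  refine (Finset.prod_le_pow_card _ _ _ fun t _ => hentry _ _).trans_eq ?_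
  simp

variable {M}

theorem maxCycleMean_le_one_iff : maxCycleMean M ≤ 1 ↔
    ∀ (p : ℕ) (hp : 0 < p) (c : Fin p → Fin n),
      ∏ t : Fin p, M (c t) (c ⟨((t : ℕ) + 1) % p, Nat.mod_lt _ hp⟩) ≤ 1 := by
  have hroot : ∀ (r : ℝ≥0) (p : ℕ), 0 < p → (r ^ ((1 : ℝ) / (p : ℝ)) ≤ 1 ↔ r ≤ 1) := by
    intro r p hp
    rw [one_div, NNReal.rpow_inv_le_iff (by exact_mod_cast hp), NNReal.one_rpow]
  constructor
  · intro h p hp c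
    exact (hroot _ p hp).1 ((le_csSup (bddAbove_cycle_means M) ⟨p, hp, c, rfl⟩).trans h)
  · intro h
    refine csSup_le' ?_
    rintro w ⟨p, hp, c, rfl⟩
    exact (hroot _ p hp).2 (h p hp c)

theorem one_le_maxCycleMean (hn : 0 < n) (hdiag : ∀ i, 1 ≤ M i i) : 1 ≤ maxCycleMean M := by
  refine (hdiag ⟨0, hn⟩).trans
    (le_csSup (bddAbove_cycle_means M) ⟨1, one_pos, fun _ => ⟨0, hn⟩, ?_⟩)
  simp

theorem mPow_mul_le (s t : ℕ) (i l j : Fin n) :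
    mPow M s i l * mPow M t l j ≤ mPow M (s + t) i j := by
  induction t generalizing j with
  | zero =>
    by_cases h : l = j
    · simp [mPow, mId, h]
    · simp [mPow, mId, h]
  | succ t ih =>
    change mPow M s i l * (Finset.univ.sup fun q => mPow M t l q * M q j) ≤ _
    rw [NNReal.mul_finset_sup]
    refine Finset.sup_le fun q _ => ?_
    rw [← mul_assoc]
    exact (mul_le_mul_left (ih q) _).trans (mul_le_mProd (mPow M (s + t)) M i q j)

theorem prod_walk_le_mPow (w : ℕ → Fin n) (t : ℕ) :
    ∏ s ∈ Finset.range t, M (w s) (w (s + 1)) ≤ mPow M t (w 0) (w t) := by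
  induction t with
  | zero => simp [mPow, mId]
  | succ t ih =>
    rw [Finset.prod_range_succ]
    exact (mul_le_mul_left ih _).trans (mul_le_mProd (mPow M t) M _ _ _)

theorem exists_walk_of_mPow (t : ℕ) (i j : Fin n) (h : mPow M t i j ≠ 0) :
    ∃ w : ℕ → Fin n, w 0 = i ∧ w t = j ∧
      mPow M t i j = ∏ s ∈ Finset.range t, M (w s) (w (s + 1)) := by
  induction t generalizing j with
  | zero =>
    have hij : i = j := by
      by_contra hij
      exact h (by simp [mPow, mId, hij])
    exact ⟨fun _ => i, rfl, hij, by simp [mPow, mId, hij]⟩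
  | succ t ih =>
    obtain ⟨q, -, hq⟩ := Finset.exists_mem_eq_sup Finset.univ ⟨i, Finset.mem_univ i⟩
      fun q => mPow M t i q * M q j
    replace hq : mPow M (t + 1) i j = mPow M t i q * M q j := hq
    obtain ⟨w, h0, ht, hw⟩ := ih q (left_ne_zero_of_mul (hq ▸ h))
    refine ⟨fun s => if s ≤ t then w s else j, by simp [h0], by simp, ?_⟩
    rw [hq, Finset.prod_range_succ, hw]
    congr 1
    · refine Finset.prod_congr rfl fun s hs => ?_
      have hs' := Finset.mem_range.1 hs
      simp [hs'.le, Nat.succ_le_of_lt hs']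
    · simp [ht]

theorem prod_closed_walk_le_one (h : maxCycleMean M ≤ 1) (w : ℕ → Fin n) (p : ℕ)
    (hw : w p = w 0) : ∏ s ∈ Finset.range p, M (w s) (w (s + 1)) ≤ 1 := by
  rcases Nat.eq_zero_or_pos p with rfl | hp
  · simp
  rw [Finset.prod_range]
  refine le_trans (le_of_eq (Finset.prod_congr rfl fun t _ => ?_))
    (maxCycleMean_le_one_iff.1 h p hp fun t => w t)
  rcases Nat.lt_or_ge ((t : ℕ) + 1) p with ht | ht
  · simp [Nat.mod_eq_of_lt ht]
  · have : (t : ℕ) + 1 = p := le_antisymm t.2 ht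
    simp [this, hw]

theorem mPow_le_kleene_of_lt {t : ℕ} (ht : t < n) (i j : Fin n) : mPow M t i j ≤ kleene M i j :=
  Finset.le_sup (f := fun t => mPow M t i j) (Finset.mem_range.2 ht)

theorem mPow_le_kleene (h : maxCycleMean M ≤ 1) (t : ℕ) (i j : Fin n) :
    mPow M t i j ≤ kleene M i j := by
  induction t using Nat.strong_induction_on with
  | _ t ih =>
    rcases Nat.lt_or_ge t n with ht | ht
    · exact mPow_le_kleene_of_lt ht i j
    by_cases hzero : mPow M t i j = 0
    · simp [hzero]
    obtain ⟨w, rfl, rfl, hw⟩ := exists_walk_of_mPow t i j hzero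
    obtain ⟨a, b, hab, hbt, heq⟩ : ∃ a b : ℕ, a < b ∧ b ≤ t ∧ w a = w b := by
      obtain ⟨a, b, hne, heq⟩ := Fintype.exists_ne_map_eq_of_card_lt
        (fun s : Fin (n + 1) => w s) (by simp)
      rcases lt_or_gt_of_ne hne with hlt | hlt
      · exact ⟨a, b, hlt, (Nat.le_of_lt_succ b.2).trans ht, heq⟩
      · exact ⟨b, a, hlt, (Nat.le_of_lt_succ a.2).trans ht, heq.symm⟩
    obtain ⟨p, rfl⟩ := Nat.exists_eq_add_of_lt hab
    obtain ⟨q, rfl⟩ := Nat.exists_eq_add_of_le hbt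
    have hcyc := prod_closed_walk_le_one h (fun s => w (a + s)) (p + 1) heq.symm
    have hpre := prod_walk_le_mPow (M := M) w a
    have hpost := prod_walk_le_mPow (M := M) (fun s => w (a + p + 1 + s)) q
    refine le_trans ?_ (ih (a + q) (by omega))
    refine le_trans ?_ (mPow_mul_le a q _ (w a) _)
    rw [hw, Finset.prod_range_add, add_assoc a p 1, Finset.prod_range_add]
    refine mul_le_mul' ((mul_le_mul' hpre hcyc).trans_eq (mul_one _)) ?_
    rw [heq]
    exact hpost

theorem one_le_kleene_diag (i : Fin n) : 1 ≤ kleene M i i := by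
  have := mPow_le_kleene_of_lt (M := M) i.pos i i
  simpa [mPow, mId] using this

theorem mul_kleene_le (h : maxCycleMean M ≤ 1) (i t j : Fin n) :
    M i t * kleene M t j ≤ kleene M i j := by
  rw [kleene, NNReal.mul_finset_sup]
  refine Finset.sup_le fun s _ => le_trans ?_ (mPow_le_kleene h (1 + s) i j)
  have h1 : M i t ≤ mPow M 1 i t := by
    simpa [mPow, mId] using mul_le_mProd (mId n) M i i t
  exact (mul_le_mul_left h1 _).trans (mPow_mul_le 1 s i t j)

theorem subEigCone_subset_mPow (t : ℕ) : subEigCone M ⊆ subEigCone (mPow M t) := by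
  intro x hx
  induction t with
  | zero =>
    refine mem_subEigCone_iff.2 fun i j => ?_
    by_cases h : i = j <;> simp [mPow, mId, h]
  | succ t ih =>
    refine mulVec_mProd_le_iff.2 (mulVec_le_iff.2 fun i j => ?_)
    exact (mul_le_mul_right (hx j) _).trans (mem_subEigCone_iff.1 ih i j)

theorem subEigCone_subset_kleene : subEigCone M ⊆ subEigCone (kleene M) := by
  refine fun x hx => mem_subEigCone_iff.2 fun i j => ?_
  rw [kleene, NNReal.finset_sup_mul]
  exact Finset.sup_le fun t _ => mem_subEigCone_iff.1 (subEigCone_subset_mPow t hx) i j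

theorem matSpan_kleene (h : maxCycleMean M ≤ 1) : matSpan (kleene M) = subEigCone M :=
  matSpan_eq_subEigCone one_le_kleene_diag (mul_kleene_le h) subEigCone_subset_kleene

/-- A matrix has a positive subeigenvector exactly when its maximum cycle mean is at most one. -/
theorem exists_pos_subEig_iff :
    (∃ x ∈ subEigCone M, ∀ i, 0 < x i) ↔ maxCycleMean M ≤ 1 := by
  constructor
  · rintro ⟨x, hx, hpos⟩
    exact maxCycleMean_le_one_iff.2 (cycle_prod_le_one_of_subEig M hx hpos)
  · intro h
    refine ⟨mulVec (kleene M) 1, matSpan_kleene h ▸ ⟨1, rfl⟩, fun i => ?_⟩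
    refine zero_lt_one.trans_le ((one_le_kleene_diag (M := M) i).trans ?_)
    simpa using mul_le_mulVec (kleene M) 1 i i

theorem exists_pos_subEig_iff_maxCycleMean_eq_one (hn : 0 < n) (hdiag : ∀ i, 1 ≤ M i i) :
    (∃ x ∈ subEigCone M, ∀ i, 0 < x i) ↔ maxCycleMean M = 1 :=
  exists_pos_subEig_iff.trans (one_le_maxCycleMean hn hdiag).ge_iff_eq'

end CycleMean

theorem subEigCone_antitone {n : ℕ} {M N : Matrix (Fin n) (Fin n) ℝ≥0}
    (h : ∀ i j, M i j ≤ N i j) : subEigCone N ⊆ subEigCone M := fun _ hx =>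
  mem_subEigCone_iff.2 fun i j =>
    (mul_le_mul_left (h i j) _).trans (mem_subEigCone_iff.1 hx i j)

theorem one_le_foldr_mProd_diag {n : ℕ} (L : List (Matrix (Fin n) (Fin n) ℝ≥0))
    (hL : ∀ Q ∈ L, ∀ i, 1 ≤ Q i i) (i : Fin n) : 1 ≤ L.foldr mProd (mId n) i i := by
  induction L with
  | nil => simp [mId]
  | cons Q L ih =>
    rw [List.forall_mem_cons] at hL
    exact (one_le_mul (hL.1 i) (ih hL.2)).trans (mul_le_mProd Q _ i i i)

theorem le_foldr_mProd {n : ℕ} (L : List (Matrix (Fin n) (Fin n) ℝ≥0))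
    (hL : ∀ Q ∈ L, ∀ i, 1 ≤ Q i i) {Q : Matrix (Fin n) (Fin n) ℝ≥0} (hQ : Q ∈ L)
    (i j : Fin n) : Q i j ≤ L.foldr mProd (mId n) i j := by
  induction L with
  | nil => simp at hQ
  | cons R L ih =>
    rw [List.forall_mem_cons] at hL
    rcases List.mem_cons.1 hQ with rfl | hQ
    · exact (le_mul_of_one_le_right' (one_le_foldr_mProd_diag L hL.2 j)).trans
        (mul_le_mProd Q _ i j j)
    · exact (ih hL.2 hQ).trans ((le_mul_of_one_le_left' (hL.1 i)).trans
        (mul_le_mProd R _ i i j))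

theorem mem_subEigCone_foldr_mProd {n : ℕ} (L : List (Matrix (Fin n) (Fin n) ℝ≥0))
    {x : Fin n → ℝ≥0} (hx : ∀ Q ∈ L, x ∈ subEigCone Q) :
    x ∈ subEigCone (L.foldr mProd (mId n)) := by
  induction L with
  | nil =>
    refine mem_subEigCone_iff.2 fun i j => ?_
    by_cases h : i = j <;> simp [mId, h]
  | cons Q L ih =>
    rw [List.forall_mem_cons] at hx
    refine mulVec_mProd_le_iff.2 (mulVec_le_iff.2 fun i j => ?_)
    exact (mul_le_mul_right (ih hx.2 j) _).trans (mem_subEigCone_iff.1 hx.1 i j)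

theorem subEigCone_prodAll {n k : ℕ} (A : Fin k → Matrix (Fin n) (Fin n) ℝ≥0)
    (hA : ∀ s i, 1 ≤ A s i i) : subEigCone (prodAll A) = ⋂ s, subEigCone (A s) := by
  have hL : ∀ Q ∈ List.ofFn A, ∀ i, 1 ≤ Q i i := by simpa [List.mem_ofFn] using hA
  refine Set.Subset.antisymm (Set.subset_iInter fun s => subEigCone_antitone ?_) fun x hx => ?_
  · exact le_foldr_mProd _ hL (by simp [List.mem_ofFn])
  · exact mem_subEigCone_foldr_mProd _ (by simpa [List.mem_ofFn] using hx)

theorem one_le_prodAll_diag {n k : ℕ} (A : Fin k → Matrix (Fin n) (Fin n) ℝ≥0)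
    (hA : ∀ s i, 1 ≤ A s i i) (i : Fin n) : 1 ≤ prodAll A i i :=
  one_le_foldr_mProd_diag _ (by simpa [List.mem_ofFn] using hA) i

theorem subEigCone_sup {n k : ℕ} (A : Fin k → Matrix (Fin n) (Fin n) ℝ≥0) :
    subEigCone ((fun i j => Finset.univ.sup fun s => A s i j) : Matrix (Fin n) (Fin n) ℝ≥0) =
      ⋂ s, subEigCone (A s) := by
  ext x
  refine mem_subEigCone_iff.trans ?_
  simp only [Set.mem_iInter, mem_subEigCone_iff, NNReal.finset_sup_mul, Finset.sup_le_iff,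
    Finset.mem_univ, true_implies]
  exact ⟨fun h s i j => h i j s, fun h i j s => h s i j⟩

/-- intersections of Kleene cones. -/
theorem stmt8 {n k : ℕ} (hn : 0 < n) (hk : 0 < k)
    (A : Fin k → Matrix (Fin n) (Fin n) ℝ≥0) (hA : ∀ s, IsKleeneStar (A s)) :
    List.TFAE
      [ ∃ x : Fin n → ℝ≥0, (∀ s, x ∈ matSpan (A s)) ∧ ∀ i, 0 < x i,
        maxCycleMean ((fun i j => Finset.univ.sup fun s => A s i j) :
          Matrix (Fin n) (Fin n) ℝ≥0) = 1,
        ∃ π : Equiv.Perm (Fin k), maxCycleMean (prodAll fun t => A (π t)) = 1,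
        ∀ π : Equiv.Perm (Fin k), maxCycleMean (prodAll fun t => A (π t)) = 1 ] ∧
    ((∃ x : Fin n → ℝ≥0, (∀ s, x ∈ matSpan (A s)) ∧ ∀ i, 0 < x i) →
      (⋂ s, matSpan (A s)) =
        matSpan (kleene ((fun i j => Finset.univ.sup fun s => A s i j) :
          Matrix (Fin n) (Fin n) ℝ≥0)) ∧
      ∀ π : Equiv.Perm (Fin k),
        (⋂ s, matSpan (A s)) = matSpan (kleene (prodAll fun t => A (π t)))) := by
  have hdiag : ∀ s i, 1 ≤ A s i i := fun s i => ((hA s).2 i).ge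
  set B : Matrix (Fin n) (Fin n) ℝ≥0 := fun i j => Finset.univ.sup fun s => A s i j
  have hspan : ⋂ s, matSpan (A s) = ⋂ s, subEigCone (A s) :=
    Set.iInter_congr fun s => (hA s).matSpan_eq
  have hBcone : subEigCone B = ⋂ s, matSpan (A s) := (subEigCone_sup A).trans hspan.symm
  have hPcone : ∀ π : Equiv.Perm (Fin k),
      subEigCone (prodAll fun t => A (π t)) = ⋂ s, matSpan (A s) := fun π =>
    (subEigCone_prodAll _ fun s => hdiag (π s)).trans
      ((π.surjective.iInter_comp fun s => subEigCone (A s)).trans hspan.symm)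
  have hBdiag : ∀ i, 1 ≤ B i i := fun i => (hdiag ⟨0, hk⟩ i).trans
    (Finset.le_sup (f := fun s => A s i i) (Finset.mem_univ _))
  have hB1 : (∃ x : Fin n → ℝ≥0, (∀ s, x ∈ matSpan (A s)) ∧ ∀ i, 0 < x i) ↔
      maxCycleMean B = 1 := by
    rw [← exists_pos_subEig_iff_maxCycleMean_eq_one hn hBdiag, hBcone]
    simp only [Set.mem_iInter]
  have hP1 : ∀ π : Equiv.Perm (Fin k),
      (∃ x : Fin n → ℝ≥0, (∀ s, x ∈ matSpan (A s)) ∧ ∀ i, 0 < x i) ↔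
        maxCycleMean (prodAll fun t => A (π t)) = 1 := fun π => by
    rw [← exists_pos_subEig_iff_maxCycleMean_eq_one hn
      (one_le_prodAll_diag _ fun s => hdiag (π s)), hPcone π]
    simp only [Set.mem_iInter]
  refine ⟨?_, fun h => ⟨?_, fun π => ?_⟩⟩
  · tfae_have 1 ↔ 2 := hB1
    tfae_have 1 → 4 := fun h π => (hP1 π).1 h
    tfae_have 4 → 3 := fun h => ⟨1, h 1⟩
    tfae_have 3 → 1 := fun ⟨π, h⟩ => (hP1 π).2 h
    tfae_finish
  · rw [matSpan_kleene (hB1.1 h).le, hBcone]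
  · rw [matSpan_kleene ((hP1 π).1 h).le, hPcone π]

end MaxAlg
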